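/- Drift bound over one mixing time: for any sequence of transitions (s_t, s_t') ∈ S × S, define w_{t+1} = w_t + η_t g^r_{s_t, s_t'}(w_t) with exponential step-sizes η_t = η₀ α^t, α = (1/T)^{1/T}, with T ≥ max{3, 1/η₀}, (ln T)²/T ≤ 1/(2a), (ln T)/T ≤ 1/b, and ln T ≥ max{a, b}. Let t ≥ τ_mix and suppose ‖w_k − w_r*‖² ≤ B(τ_mix) for all k ∈ {1, …, t}, where B(τ_mix) = exp(2(2+λ) max{a, b}) · (‖w_1 − w_r*‖ + ζ)². Then ‖w_t − w_{t−τ_mix}‖² ≤ c₁² · B(τ_mix) · η_t² · (ln T)⁴, where c₁² = 2560(2+λ)². -/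

import Mathlib

open scoped RealInnerProductSpace BigOperators

/-- The TD(0) update direction for a transition `(s, s')`:
`g_{s,s'}(w) = (r(s) + γ ⟪w, φ s'⟫ − ⟪w, φ s⟫) φ(s)`. -/
noncomputable def tdDir {S : Type*} {d : ℕ} (φ : S → EuclideanSpace ℝ (Fin d))
    (r : S → ℝ) (γ : ℝ) (s s' : S) (w : EuclideanSpace ℝ (Fin d)) :
    EuclideanSpace ℝ (Fin d) :=
  (r s + γ * ⟪w, φ s'⟫ - ⟪w, φ s⟫) • φ s

/-- The mean-path TD(0) direction `g(w) = ∑_{s,s'} μ(s) P(s,s') g_{s,s'}(w)`. -/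
noncomputable def meanDir {S : Type*} [Fintype S] {d : ℕ}
    (P : S → S → ℝ) (μ : S → ℝ) (φ : S → EuclideanSpace ℝ (Fin d))
    (r : S → ℝ) (γ : ℝ) (w : EuclideanSpace ℝ (Fin d)) :
    EuclideanSpace ℝ (Fin d) :=
  ∑ s, ∑ s', (μ s * P s s') • tdDir φ r γ s s' w

/-- The regularized stochastic TD(0) direction `g^r_{s,s'}(w) = g_{s,s'}(w) − λ w`. -/
noncomputable def regTdDir {S : Type*} {d : ℕ} (φ : S → EuclideanSpace ℝ (Fin d))
    (r : S → ℝ) (γ lam : ℝ) (s s' : S) (w : EuclideanSpace ℝ (Fin d)) :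
    EuclideanSpace ℝ (Fin d) :=
  tdDir φ r γ s s' w - lam • w

/-- The regularized mean-path TD(0) direction `g^r(w) = g(w) − λ w`. -/
noncomputable def regMeanDir {S : Type*} [Fintype S] {d : ℕ}
    (P : S → S → ℝ) (μ : S → ℝ) (φ : S → EuclideanSpace ℝ (Fin d))
    (r : S → ℝ) (γ lam : ℝ) (w : EuclideanSpace ℝ (Fin d)) :
    EuclideanSpace ℝ (Fin d) :=
  meanDir P μ φ r γ w - lam • w

/-- One step of the distribution dynamics: `(ν P)(s') = ∑_s ν(s) P(s,s')`. -/
noncomputable def pushDist {S : Type*} [Fintype S] (P : S → S → ℝ) (ν : S → ℝ) : S → ℝ :=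
  fun s' => ∑ s, ν s * P s s'

/-- The regularized TD(0) direction grows at most affinely. -/
lemma norm_regTdDir_le {S : Type*} {d : ℕ} (φ : S → EuclideanSpace ℝ (Fin d)) (r : S → ℝ)
    {γ lam : ℝ} (hφ : ∀ s, ‖φ s‖ ≤ 1) (hr : ∀ s, 0 ≤ r s ∧ r s ≤ 1) (hγ : 0 < γ ∧ γ ≤ 1)
    (hlam : 0 ≤ lam) (s s' : S) (w : EuclideanSpace ℝ (Fin d)) :
    ‖regTdDir φ r γ lam s s' w‖ ≤ 1 + (2 + lam) * ‖w‖ := by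
  have hinner : ∀ x : S, |⟪w, φ x⟫| ≤ ‖w‖ := fun x =>
    (abs_real_inner_le_norm w (φ x)).trans (mul_le_of_le_one_right (norm_nonneg w) (hφ x))
  have hcoef : |r s + γ * ⟪w, φ s'⟫ - ⟪w, φ s⟫| ≤ 1 + 2 * ‖w‖ := by
    have h1 : |γ * ⟪w, φ s'⟫| ≤ ‖w‖ := by
      rw [abs_mul, abs_of_pos hγ.1]
      exact (mul_le_of_le_one_left (abs_nonneg _) hγ.2).trans (hinner s')
    have h2 := hinner s
    have h3 := hr s
    rw [abs_le] at h1 h2 ⊢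
    constructor <;> linarith
  calc ‖regTdDir φ r γ lam s s' w‖
      ≤ ‖(r s + γ * ⟪w, φ s'⟫ - ⟪w, φ s⟫) • φ s‖ + ‖lam • w‖ := norm_sub_le _ _
    _ ≤ (1 + 2 * ‖w‖) + lam * ‖w‖ := by
        rw [norm_smul, norm_smul, Real.norm_eq_abs, Real.norm_eq_abs, abs_of_nonneg hlam]
        gcongr
        exact (mul_le_of_le_one_right (abs_nonneg _) (hφ s)).trans hcoef
    _ = 1 + (2 + lam) * ‖w‖ := by ring

/-- A geometric sum with ratio at least one is at most its trapezoidal value. -/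
lemma two_mul_sum_pow_succ_le {q : ℝ} (hq : 1 ≤ q) (n : ℕ) :
    2 * ∑ j ∈ Finset.range n, q ^ (j + 1) ≤ n * (q + q ^ n) := by
  have hstep : ∀ n : ℕ, q ^ (n + 1) - q ≤ n * q ^ n * (q - 1) := by
    intro n
    induction n with
    | zero => simp
    | succ n ih =>
      have h1 : 0 ≤ q ^ n * (q - 1) ^ 2 * n := by positivity
      push_cast
      have e1 : q ^ (n + 1 + 1) = q ^ n * q * q := by ring
      have e2 : q ^ (n + 1) = q ^ n * q := by ring
      rw [e2] at ih
      rw [e1, e2]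
      nlinarith
  induction n with
  | zero => simp
  | succ n ih =>
    rw [Finset.sum_range_succ]
    have h := hstep n
    have e : q ^ (n + 1) = q ^ n * q := by ring
    rw [e] at h ⊢
    push_cast
    nlinarith

/-- If the increments of a sequence between times `t - n` and `t` are bounded by `C * α ^ k`, its
displacement is bounded by `C * α ^ t` times a geometric sum in `α⁻¹`. -/
lemma norm_sub_le_of_geometric_increments {E : Type*} [SeminormedAddCommGroup E] (w : ℕ → E)
    {C α : ℝ} (hα : 0 < α) {t : ℕ} (hstep : ∀ k < t, ‖w (k + 1) - w k‖ ≤ C * α ^ k) :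
    ∀ n ≤ t, ‖w t - w (t - n)‖ ≤ C * α ^ t * ∑ j ∈ Finset.range n, α⁻¹ ^ (j + 1) := by
  intro n
  induction n with
  | zero => simp
  | succ n ih =>
    intro hn
    have h1 := ih (by omega)
    have h2 := hstep (t - (n + 1)) (by omega)
    have e1 : t - (n + 1) + 1 = t - n := by omega
    have e2 : α ^ (t - (n + 1)) = α ^ t * α⁻¹ ^ (n + 1) := by
      rw [pow_sub₀ _ hα.ne' hn, inv_pow]
    rw [e1, e2] at h2
    have h3 := norm_sub_le_norm_sub_add_norm_sub (w t) (w (t - n)) (w (t - (n + 1)))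
    rw [Finset.sum_range_succ]
    linarith

/-- Upper bound on the first time at which `m * ρ ^ n` drops below a threshold `c`. -/
lemma first_hitting_time_lt {m ρ c : ℝ} (hm : 0 < m) (hρ : 0 < ρ ∧ ρ < 1) (hc : 0 < c) {n : ℕ}
    (hn : 0 < n) (hmin : ∀ n' < n, c < m * ρ ^ n') :
    (n : ℝ) < Real.log (m / c) / Real.log (1 / ρ) + 1 := by
  have hlog : 0 < Real.log (1 / ρ) := Real.log_pos (by rw [lt_div_iff₀ hρ.1]; linarith [hρ.2])
  have h := Real.log_lt_log hc (hmin (n - 1) (by omega))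
  rw [Real.log_mul hm.ne' (pow_pos hρ.1 _).ne', Real.log_pow, Nat.cast_sub hn] at h
  rw [← sub_lt_iff_lt_add, lt_div_iff₀ hlog, Real.log_div hm.ne' hc.ne', one_div, Real.log_inv]
  push_cast at h
  linarith

/-- A threshold `c = η₀ / (2 (2 + lam) T)` with `1 / η₀ ≤ T` is hit by `m * ρ ^ n` within
`2 a log T + b + 1` steps. -/
lemma mixing_time_le {m ρ lam η₀ T a b : ℝ} (hm : 0 < m) (hρ : 0 < ρ ∧ ρ < 1) (hlam : 0 ≤ lam)
    (hη₀ : 0 < η₀) (hT : 0 < T) (hTη : 1 / η₀ ≤ T)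
    (ha : a = 1 / Real.log (1 / ρ))
    (hb : b = Real.log (2 * (2 + lam) * m) / Real.log (1 / ρ)) {n : ℕ} (hn : 0 < n)
    (hmin : ∀ n' < n, η₀ / (2 * (2 + lam) * T) < m * ρ ^ n') :
    (n : ℝ) ≤ 2 * a * Real.log T + b + 1 := by
  have hlog : 0 < Real.log (1 / ρ) := Real.log_pos (by rw [lt_div_iff₀ hρ.1]; linarith [hρ.2])
  have h := first_hitting_time_lt hm hρ (by positivity) hn hmin
  have e : m / (η₀ / (2 * (2 + lam) * T)) = 2 * (2 + lam) * m * (1 / η₀ * T) := by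
    field_simp
  have hle : Real.log (1 / η₀ * T) ≤ 2 * Real.log T := by
    rw [Real.log_mul (by positivity) hT.ne']
    linarith [Real.log_le_log (by positivity) hTη]
  rw [e, Real.log_mul (by positivity) (by positivity), add_div, ← hb] at h
  have h2 : Real.log (1 / η₀ * T) / Real.log (1 / ρ) ≤ 2 * a * Real.log T := by
    calc Real.log (1 / η₀ * T) / Real.log (1 / ρ) ≤ 2 * Real.log T / Real.log (1 / ρ) := by gcongr
      _ = 2 * a * Real.log T := by rw [ha]; ring
  linarith

/-- `x ^ 2 + x ≤ exp x` for nonnegative `x`. -/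
lemma sq_add_self_le_exp {x : ℝ} (hx : 0 ≤ x) : x ^ 2 + x ≤ Real.exp x := by
  have h := Real.sum_le_exp_of_nonneg hx 4
  norm_num [Finset.sum_range_succ, Nat.factorial] at h
  nlinarith [mul_nonneg (by linarith : (0 : ℝ) ≤ x + 1) (sq_nonneg (x - 2))]

/-- drift bound over one mixing time.  For regularized TD(0) iterates
with exponential step-sizes, if `t ≥ τ_mix` and `‖w_k − w_r*‖² ≤ B(τ_mix)` for all
`k ∈ {1,…,t}`, then `‖w_t − w_{t−τ_mix}‖² ≤ c₁² B(τ_mix) η_t² (ln T)⁴`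
with `c₁² = 2560(2+λ)²`. -/
theorem reg_td0_drift_over_mixing_time
    {S : Type*} [Fintype S] {d : ℕ}
    (P : S → S → ℝ) (μ : S → ℝ) (φ : S → EuclideanSpace ℝ (Fin d))
    (r : S → ℝ) (γ lam : ℝ) (wr : EuclideanSpace ℝ (Fin d))
    (hP : ∀ s s', 0 ≤ P s s') (hProw : ∀ s, ∑ s', P s s' = 1)
    (hμ : ∀ s, 0 ≤ μ s) (hμsum : ∑ s, μ s = 1)
    (hstat : ∀ s', ∑ s, μ s * P s s' = μ s')
    (hφ : ∀ s, ‖φ s‖ ≤ 1)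
    (hr : ∀ s, 0 ≤ r s ∧ r s ≤ 1)
    (hγ : 0 < γ ∧ γ ≤ 1)
    (hlam : 0 ≤ lam)
    (hwr : regMeanDir P μ φ r γ lam wr = 0)
    -- geometric mixing with constants `m`, `ρ`, and `a = 1/ln(1/ρ)`,
    -- `b = ln(2(2+λ)m)/ln(1/ρ)`
    (m ρ : ℝ) (hm : 0 < m) (hρ : 0 < ρ ∧ ρ < 1)
    (hmix : ∀ ν : S → ℝ, (∀ s, 0 ≤ ν s) → ∑ s, ν s = 1 →
      ∀ t : ℕ, (1 / 2) * ∑ s, |(pushDist P)^[t] ν s - μ s| ≤ m * ρ ^ t)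
    (a b : ℝ)
    (ha : a = 1 / Real.log (1 / ρ))
    (hb : b = Real.log (2 * (2 + lam) * m) / Real.log (1 / ρ))
    -- horizon and exponential step-size schedule
    (T : ℕ) (η₀ α : ℝ)
    (hα : α = (1 / (T : ℝ)) ^ ((1 : ℝ) / (T : ℝ)))
    (hη₀ : 0 < η₀ ∧ η₀ ≤ 1)
    (hT3 : (3 : ℝ) ≤ (T : ℝ)) (hTη : 1 / η₀ ≤ (T : ℝ))
    (hTa : (Real.log T) ^ 2 / (T : ℝ) ≤ 1 / (2 * a))
    (hTb : Real.log T / (T : ℝ) ≤ 1 / b)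
    (hTab : max a b ≤ Real.log T)
    -- the mixing time `τ_mix = min{t ∈ ℕ : m ρ^t ≤ η₀/(2(2+λ)T)}`
    (τmix : ℕ)
    (hτmix : m * ρ ^ τmix ≤ η₀ / (2 * (2 + lam) * T))
    (hτmixMin : ∀ t' : ℕ, t' < τmix → η₀ / (2 * (2 + lam) * T) < m * ρ ^ t')
    -- an arbitrary sequence of transitions and the corresponding iterates
    (st : ℕ → S × S) (w : ℕ → EuclideanSpace ℝ (Fin d))
    (hw0 : w 0 = w 1)
    (hrec : ∀ k, 1 ≤ k →
      w (k + 1) = w k + (η₀ * α ^ k) • regTdDir φ r γ lam (st k).1 (st k).2 (w k))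
    -- the time `t` and the inductive boundedness hypothesis, with
    -- `B(τ_mix) = exp(2(2+λ) max{a,b}) (‖w₁ − w_r*‖ + ζ)²`
    (t : ℕ) (ht : τmix ≤ t)
    (hbound : ∀ k, 1 ≤ k → k ≤ t →
      ‖w k - wr‖ ^ 2 ≤
        Real.exp (2 * (2 + lam) * max a b) * (‖w 1 - wr‖ + max 1 ‖wr‖) ^ 2) :
    ‖w t - w (t - τmix)‖ ^ 2 ≤
      2560 * (2 + lam) ^ 2 *
        (Real.exp (2 * (2 + lam) * max a b) * (‖w 1 - wr‖ + max 1 ‖wr‖) ^ 2) *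
        (η₀ * α ^ t) ^ 2 * (Real.log T) ^ 4 := by
  set l := Real.log T with hl
  set L := 2 + lam with hL
  set M := max a b
  set D := ‖w 1 - wr‖ + max 1 ‖wr‖ with hD
  have hTpos : (0 : ℝ) < T := by linarith
  have hl1 : 1 ≤ l := by
    rw [hl, Real.le_log_iff_exp_le hTpos]
    linarith [Real.exp_one_lt_three]
  have hexpl : Real.exp l = T := Real.exp_log hTpos
  have hapos : 0 < a := by
    rw [ha]
    exact one_div_pos.2 (Real.log_pos (by rw [lt_div_iff₀ hρ.1]; linarith [hρ.2]))
  have hbpos : 0 < b := by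
    have : 0 < 1 / b := lt_of_lt_of_le (by positivity) hTb
    exact one_div_pos.1 this
  have hal : a ≤ l := (le_max_left a b).trans hTab
  have hbl : b ≤ l := (le_max_right a b).trans hTab
  have hMpos : 0 < M := lt_of_lt_of_le hapos (le_max_left a b)
  have hτ : (τmix : ℝ) ≤ 2 * a * l + b + 1 := by
    rcases Nat.eq_zero_or_pos τmix with h0 | h0
    · rw [h0, Nat.cast_zero]
      positivity
    · exact mixing_time_le hm hρ hlam hη₀.1 hTpos hTη ha hb h0 hτmixMin
  have hτl : (τmix : ℝ) ≤ 4 * l ^ 2 := by nlinarith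
  have hTl : l ^ 2 + l ≤ T := hexpl ▸ sq_add_self_le_exp (by linarith)
  have hτT : τmix * (l / T) ≤ 2 := by
    have h1 : 2 * a * l ^ 2 ≤ T := by
      rw [div_le_div_iff₀ hTpos (by positivity)] at hTa
      linarith
    rw [← mul_div_assoc, div_le_iff₀ hTpos]
    nlinarith
  have hα' : α = Real.exp (-(l / T)) := by
    rw [hα, Real.rpow_def_of_pos (by positivity), one_div, Real.log_inv]
    congr 1
    ring
  have hαpos : 0 < α := hα' ▸ Real.exp_pos _
  have hinv : α⁻¹ = Real.exp (l / T) := by rw [hα', ← Real.exp_neg, neg_neg]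
  have hlT : l / T ≤ 1 / 2 := by
    rw [div_le_iff₀ hTpos]
    nlinarith
  have hq1 : 1 ≤ α⁻¹ := hinv ▸ Real.one_le_exp (by positivity)
  have hq2 : α⁻¹ ≤ 2 := by
    have h : 1 / 2 ≤ α := by
      rw [hα']
      linarith [Real.add_one_le_exp (-(l / T))]
    rw [inv_le_comm₀ hαpos two_pos]
    linarith
  have hqτ : α⁻¹ ^ τmix ≤ 7.4 := by
    rw [hinv, ← Real.exp_nat_mul]
    refine (Real.exp_le_exp.2 hτT).trans ?_
    have h := Real.exp_one_lt_d9
    have e : Real.exp 2 = Real.exp 1 ^ 2 := by rw [← Real.exp_nat_mul]; norm_num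
    have h2 : Real.exp 1 ^ 2 ≤ 2.7182818286 ^ 2 := by gcongr
    rw [e]
    norm_num at h2 ⊢
    linarith only [h2]
  have hsum : ∑ j ∈ Finset.range τmix, α⁻¹ ^ (j + 1) ≤ 18.8 * l ^ 2 := by
    have h := two_mul_sum_pow_succ_le hq1 τmix
    have h2 : (τmix : ℝ) * (α⁻¹ + α⁻¹ ^ τmix) ≤ 4 * l ^ 2 * (2 + 7.4) := by gcongr
    linarith
  set R := Real.exp (L * M) * D with hR
  have hB : Real.exp (2 * L * M) * D ^ 2 = R ^ 2 := by
    rw [hR, mul_pow, ← Real.exp_nat_mul]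
    congr 2
    push_cast
    ring
  rw [hB] at hbound ⊢
  have hL2 : 2 ≤ L := by linarith
  have hDR : D ≤ R := le_mul_of_one_le_left (by positivity) (Real.one_le_exp (by positivity))
  have hR1 : 1 ≤ R := by linarith [le_max_left 1 ‖wr‖, norm_nonneg (w 1 - wr)]
  have hwrR : ‖wr‖ ≤ R := by linarith [le_max_right 1 ‖wr‖, norm_nonneg (w 1 - wr)]
  have hstep : ∀ k < t, ‖w (k + 1) - w k‖ ≤ 2.5 * L * R * η₀ * α ^ k := by
    intro k hk
    have hη₀pos := hη₀.1
    rcases Nat.eq_zero_or_pos k with rfl | hk1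
    · rw [zero_add, hw0, sub_self, norm_zero]
      positivity
    · have h1 : ‖w k - wr‖ ≤ R := by
        have := hbound k hk1 hk.le
        exact (pow_le_pow_iff_left₀ (norm_nonneg _) (by linarith) two_ne_zero).1 this
      have h2 : ‖w k‖ ≤ 2 * R := by
        have := norm_add_le (w k - wr) wr
        rw [sub_add_cancel] at this
        linarith
      have h3 : ‖regTdDir φ r γ lam (st k).1 (st k).2 (w k)‖ ≤ 2.5 * L * R := by
        have := norm_regTdDir_le φ r hφ hr hγ hlam (st k).1 (st k).2 (w k)
        rw [← hL] at this
        have h4 : L * ‖w k‖ ≤ L * (2 * R) := by gcongr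
        have h5 : 2 * 1 ≤ L * R := by gcongr
        linarith
      rw [hrec k hk1, add_sub_cancel_left, norm_smul, Real.norm_of_nonneg (by positivity)]
      calc η₀ * α ^ k * ‖regTdDir φ r γ lam (st k).1 (st k).2 (w k)‖
          ≤ η₀ * α ^ k * (2.5 * L * R) := by gcongr
        _ = 2.5 * L * R * η₀ * α ^ k := by ring
  have hη₀pos := hη₀.1
  calc ‖w t - w (t - τmix)‖ ^ 2
      ≤ (2.5 * L * R * η₀ * α ^ t * (18.8 * l ^ 2)) ^ 2 := by
        gcongr
        exact (norm_sub_le_of_geometric_increments w hαpos hstep τmix ht).trans (by gcongr)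
    _ = 2209 * (L ^ 2 * R ^ 2 * (η₀ * α ^ t) ^ 2 * l ^ 4) := by ring
    _ ≤ 2560 * (L ^ 2 * R ^ 2 * (η₀ * α ^ t) ^ 2 * l ^ 4) := by gcongr; norm_num
    _ = 2560 * L ^ 2 * R ^ 2 * (η₀ * α ^ t) ^ 2 * l ^ 4 := by ring
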